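/- Theorem 1: If G is a finite group that is not nonabelian simple, and w is any element of G ∗ ⟨t⟩∞, then the group G̃ = (G ∗ ⟨t⟩∞)/⟨⟨w⟩⟩ is also not nonabelian simple. -/

import Mathlib

open Monoid

/-- `G ∗ ⟨t⟩∞`: the free product of `G` with an infinite cyclic group. -/
abbrev GZ (G : Type*) [Group G] := Coprod G (FreeGroup Unit)

/-- The generator `t` of the infinite cyclic factor. -/
def tGen (G : Type*) [Group G] : GZ G := Coprod.inr (FreeGroup.of ())

/-- `G̃ = (G ∗ ⟨t⟩∞)/⟨⟨w⟩⟩`. -/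
abbrev Gtilde (G : Type*) [Group G] (w : GZ G) :=
  GZ G ⧸ Subgroup.normalClosure {w}

/-- The natural map `G → G̃`. -/
def natMap (G : Type*) [Group G] (w : GZ G) : G →* Gtilde G w :=
  (QuotientGroup.mk' (Subgroup.normalClosure {w})).comp Coprod.inl

/-- The exponent sum homomorphism `G ∗ ⟨t⟩∞ → ℤ` killing `G` and sending `t` to `1`. -/
def expSum (G : Type*) [Group G] : GZ G →* Multiplicative ℤ :=
  Coprod.lift 1 (FreeGroup.lift fun _ => Multiplicative.ofAdd (1 : ℤ))

open Matrix
open scoped ContDiff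
open Matrix
open scoped ContDiff

theorem alg_core {ι : Type*} [Fintype ι] [DecidableEq ι]
    (br : (ι → ℂ) →ₗ[ℂ] (ι → ℂ) →ₗ[ℂ] (ι → ℂ))
    (hanti : ∀ v w, br v w = - br w v)
    (hun : ∀ v, ∑ p, br v (Pi.single p 1) p = 0)
    (a b : Matrix ι ι ℂ) (hba : b * a = 1) (hab : a * b = 1)
    (Ea : ι → Matrix ι ι ℂ) (E0 : Matrix ι ι ℂ) (B : ι → ℂ) (DB : ι → ι → ℂ)
    (Φ d Φ0 : ℂ) (Φi : ι → ℂ) (L : (ι → ℂ) →ₗ[ℂ] ℂ)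
    (h1 : ∀ i q p, Ea i q p - Ea q i p =
      ∑ l, br (Pi.single i 1) (Pi.single q 1) l * a l p - br (a i) (a q) p)
    (h2 : ∀ q p, E0 q p = DB q p + br (a q) B p)
    (h3 : ∀ i, Φi i = L (a i)) (h4 : Φ0 = L B) :
    Φ0 * d + Φ * (d * (b * E0).trace) =
      ∑ i, ∑ j, (Φi i * d * b j i * B j + Φ * (d * (b * Ea i).trace) * b j i * B j
        + Φ * d * (-(b * Ea i * b)) j i * B j + Φ * d * b j i * DB i j) := by
  have hrow : ∀ j, ∑ i, b j i • a i = Pi.single j (1 : ℂ) := by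
    intro j
    ext p
    have := congrFun (congrFun hba j) p
    simp only [Matrix.mul_apply] at this
    simp [Finset.sum_apply, this, Matrix.one_apply, Pi.single_apply, eq_comm]
  have hB : B = ∑ j, B j • Pi.single j (1 : ℂ) := by
    ext p; simp [Finset.sum_apply, Pi.single_apply]
  -- first part
  have e1 : ∑ i, ∑ j, Φi i * d * b j i * B j = Φ0 * d := by
    rw [h4, hB, map_sum, Finset.sum_comm, Finset.sum_mul]
    refine Finset.sum_congr rfl fun j _ => ?_
    rw [map_smul, ← hrow j, map_sum]
    simp only [← hB, h3, map_smul, smul_eq_mul, Finset.mul_sum, Finset.sum_mul]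
    refine Finset.sum_congr rfl fun i _ => ?_
    ring
  -- trace part
  have e2 : (b * E0).trace = ∑ i, ∑ j, b j i * DB i j := by
    have hz : ∑ p, ∑ q, b p q * br (a q) B p = 0 := by
      have : ∀ p, ∑ q, b p q * br (a q) B p = - br B (Pi.single p 1) p := by
        intro p
        rw [← hrow p, map_sum, Finset.sum_apply, ← Finset.sum_neg_distrib]
        refine Finset.sum_congr rfl fun q _ => ?_
        rw [hanti (a q) B, map_smul]; simp
      simp only [this, Finset.sum_neg_distrib, hun, neg_zero]
    simp only [Matrix.trace, Matrix.diag, Matrix.mul_apply, h2, mul_add, Finset.sum_add_distrib]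
    rw [hz, add_zero, Finset.sum_comm]
  -- Piola
  have e3 : ∀ j, ∑ i, ((b * Ea i).trace * b j i - (b * Ea i * b) j i) = 0 := by
    intro j
    have s1 : ∑ i, (b * Ea i).trace * b j i = ∑ i, ∑ q, ∑ p, b j i * b p q * Ea i q p := by
      refine Finset.sum_congr rfl fun i _ => ?_
      simp only [Matrix.trace, Matrix.diag, Matrix.mul_apply, Finset.sum_mul]
      rw [Finset.sum_comm]
      refine Finset.sum_congr rfl fun q _ => Finset.sum_congr rfl fun p _ => ?_
      ring
    have s2 : ∑ i, (b * Ea i * b) j i = ∑ i, ∑ q, ∑ p, b j i * b p q * Ea q i p := by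
      rw [Finset.sum_comm (s := (Finset.univ : Finset ι)) (t := (Finset.univ : Finset ι))]
      refine Finset.sum_congr rfl fun q _ => ?_
      simp only [Matrix.mul_apply, Finset.sum_mul]
      rw [Finset.sum_comm]
      refine Finset.sum_congr rfl fun i _ => Finset.sum_congr rfl fun p _ => ?_
      ring
    rw [Finset.sum_sub_distrib, s1, s2]
    simp only [← Finset.sum_sub_distrib, ← mul_sub, h1]
    simp only [mul_sub, Finset.sum_sub_distrib]
    have t1 : ∑ i, ∑ q, ∑ p, b j i * b p q *
        ∑ l, br (Pi.single i 1) (Pi.single q 1) l * a l p = 0 := by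
      have : ∀ i q, ∑ p, b j i * b p q * ∑ l, br (Pi.single i 1) (Pi.single q 1) l * a l p
          = b j i * br (Pi.single i 1) (Pi.single q 1) q := by
        intro i q
        have hh : ∀ l, ∑ p, a l p * b p q = (1 : Matrix ι ι ℂ) l q := by
          intro l; rw [← hab, Matrix.mul_apply]
        calc _ = ∑ l, b j i * br (Pi.single i 1) (Pi.single q 1) l * ∑ p, a l p * b p q := by
              simp only [Finset.mul_sum]
              rw [Finset.sum_comm]
              refine Finset.sum_congr rfl fun q _ => Finset.sum_congr rfl fun p _ => ?_
              ring
          _ = _ := by simp [hh, Matrix.one_apply]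
      simp only [this, ← Finset.mul_sum, hun, mul_zero, Finset.sum_const_zero]
    have t2 : ∑ i, ∑ q, ∑ p, b j i * b p q * br (a i) (a q) p = 0 := by
      have : ∀ p, ∑ i, ∑ q, b j i * b p q * br (a i) (a q) p = br (Pi.single j 1) (Pi.single p 1) p := by
        intro p
        rw [← hrow j, ← hrow p]
        simp only [map_sum, LinearMap.sum_apply, map_smul, LinearMap.smul_apply,
          Finset.sum_apply, Pi.smul_apply, smul_eq_mul, Finset.mul_sum]
        rw [Finset.sum_comm]
        refine Finset.sum_congr rfl fun q _ => Finset.sum_congr rfl fun p _ => ?_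
        ring
      rw [← hun (Pi.single j 1)]
      simp only [← this]
      calc _ = ∑ i, ∑ p, ∑ q, b j i * b p q * br (a i) (a q) p :=
            Finset.sum_congr rfl fun i _ => Finset.sum_comm
        _ = _ := Finset.sum_comm
    rw [t1, t2, sub_zero]
  have e4 : ∑ i, ∑ j, (Φ * (d * (b * Ea i).trace) * b j i * B j
        + Φ * d * (-(b * Ea i * b)) j i * B j) = 0 := by
    rw [Finset.sum_comm]
    refine Finset.sum_eq_zero fun j _ => ?_
    have := congrArg (fun t => Φ * d * B j * t) (e3 j)
    simp only [mul_zero, Finset.mul_sum] at this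
    rw [← this]
    refine Finset.sum_congr rfl fun i _ => ?_
    rw [Matrix.neg_apply]; ring
  simp only [Finset.sum_add_distrib] at e4 ⊢
  rw [e1, add_assoc (Φ0 * d), e4, add_zero, e2]
  simp only [Finset.mul_sum]
  congr 1
  refine Finset.sum_congr rfl fun i _ => Finset.sum_congr rfl fun j _ => ?_
  ring
section mcsec
open scoped Matrix.Norms.Operator

theorem two_le_infty : (2 : ℕ∞ω) ≤ ∞ := by
  exact ENat.LEInfty.out

/-- logarithmic derivative of `F` along the vector field `V` -/
noncomputable def lder {R : Type*} [NormedRing R] [NormedAlgebra ℂ R] [HasSummableGeomSeries R]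
    {E : Type*} [NormedAddCommGroup E] [NormedSpace ℂ E] (F : E → R) (V : E → E) (z : E) :
    R :=
  Ring.inverse (F z) * fderiv ℂ F z (V z)

theorem lder_contDiffAt {R : Type*} [NormedRing R] [NormedAlgebra ℂ R] [HasSummableGeomSeries R]
    {E : Type*} [NormedAddCommGroup E] [NormedSpace ℂ E] {F : E → R} {V : E → E} {z : E}
    (hF : ContDiffAt ℂ ∞ F z) (hu : IsUnit (F z)) (hV : ContDiffAt ℂ ∞ V z) :
    ContDiffAt ℂ ∞ (lder F V) z := by
  obtain ⟨u, hu⟩ := hu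
  have h1 : ContDiffAt ℂ ∞ (fun z => Ring.inverse (F z)) z := by
    have := contDiffAt_ringInverse (n := ∞) ℂ u
    rw [hu] at this
    exact this.comp z hF
  have h2 : ContDiffAt ℂ ∞ (fun z => fderiv ℂ F z (V z)) z :=
    (hF.fderiv_right (m := ∞) (by simp)).clm_apply hV
  exact h1.mul h2

theorem lder_fderiv {R : Type*} [NormedRing R] [NormedAlgebra ℂ R] [HasSummableGeomSeries R]
    {E : Type*} [NormedAddCommGroup E] [NormedSpace ℂ E] {F : E → R} {V : E → E} {z : E}
    (hF : ContDiffAt ℂ ∞ F z) (hu : IsUnit (F z)) (hV : ContDiffAt ℂ ∞ V z) (v : E) :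
    fderiv ℂ (lder F V) z v =
      - (Ring.inverse (F z) * fderiv ℂ F z v * lder F V z) +
      Ring.inverse (F z) * (fderiv ℂ (fderiv ℂ F) z v (V z) + fderiv ℂ F z (fderiv ℂ V z v)) := by
  obtain ⟨u, hu⟩ := hu
  have hr := hasFDerivAt_ringInverse (𝕜 := ℂ) u
  rw [hu] at hr
  have h1 := hr.comp z (hF.differentiableAt (by simp)).hasFDerivAt
  have h2 := ((hF.fderiv_right (m := ∞) (by simp)).differentiableAt (by simp)).hasFDerivAt.clm_apply
    (hV.differentiableAt (by simp)).hasFDerivAt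
  have h3 := h1.mul' h2
  have h4 : fderiv ℂ (lder F V) z = _ := h3.fderiv
  rw [h4]
  have : (↑u⁻¹ : R) = Ring.inverse (F z) := by rw [← hu, Ring.inverse_unit]
  simp only [this, lder]
  simp [mul_assoc, add_comm, mul_add]

theorem lder_comm {R : Type*} [NormedRing R] [NormedAlgebra ℂ R] [HasSummableGeomSeries R]
    {E : Type*} [NormedAddCommGroup E] [NormedSpace ℂ E] {F : E → R} {V W : E → E} {z : E}
    (hF : ContDiffAt ℂ ∞ F z) (hu : IsUnit (F z)) (hV : ContDiffAt ℂ ∞ V z)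
    (hW : ContDiffAt ℂ ∞ W z) :
    fderiv ℂ (lder F W) z (V z) - fderiv ℂ (lder F V) z (W z) =
      Ring.inverse (F z) * fderiv ℂ F z (fderiv ℂ W z (V z) - fderiv ℂ V z (W z))
       - (lder F V z * lder F W z - lder F W z * lder F V z) := by
  rw [lder_fderiv hF hu hW, lder_fderiv hF hu hV]
  have hs : IsSymmSndFDerivAt ℂ F z := hF.isSymmSndFDerivAt (by simp; exact two_le_infty)
  have hs' : fderiv ℂ (fderiv ℂ F) z (V z) (W z) = fderiv ℂ (fderiv ℂ F) z (W z) (V z) := hs _ _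
  rw [hs']
  simp only [lder, map_sub]
  noncomm_ring

theorem det_hasFDerivAt {ι : Type*} [Fintype ι] [DecidableEq ι]
    {E : Type*} [NormedAddCommGroup E] [NormedSpace ℂ E] {a : E → Matrix ι ι ℂ} {z : E}
    (ha : DifferentiableAt ℂ a z) (hd : (a z).det ≠ 0) (v : E) :
    DifferentiableAt ℂ (fun z => (a z).det) z ∧
    fderiv ℂ (fun z => (a z).det) z v = (a z).det * ((a z)⁻¹ * fderiv ℂ a z v).trace := by
  have hdet : ContDiff ℂ ∞ (fun M : Matrix ι ι ℂ => M.det) := by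
    have hp : ∀ i j, ContDiff ℂ ∞ (fun M : Matrix ι ι ℂ => M i j) := fun i j =>
      (LinearMap.toContinuousLinearMap (Matrix.entryLinearMap ℂ ℂ i j)).contDiff
    simp only [Matrix.det_apply]
    refine ContDiff.sum fun σ _ => ContDiff.const_smul _ (contDiff_prod fun i _ => hp _ _)
  have h1 : ∀ M : Matrix ι ι ℂ, DifferentiableAt ℂ (fun M : Matrix ι ι ℂ => M.det) M := fun M =>
    hdet.contDiffAt.differentiableAt (by simp)
  refine ⟨(h1 (a z)).comp z ha, ?_⟩
  have h2 : fderiv ℂ (fun z => (a z).det) z = _ := fderiv_comp z (h1 (a z)) ha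
  rw [h2, ContinuousLinearMap.comp_apply]
  set X := fderiv ℂ a z v
  set M := a z
  have hl : HasDerivAt (fun r : ℂ => M + r • X) X 0 := by
    have := ((hasDerivAt_id (0 : ℂ)).smul_const X).const_add M
    rw [one_smul] at this
    exact this
  have h3 : HasDerivAt (fun r : ℂ => (M + r • X).det) (fderiv ℂ (fun M : Matrix ι ι ℂ => M.det) M X) 0 := by
    have h := (h1 (M + (0 : ℂ) • X)).hasFDerivAt.comp_hasDerivAt 0 hl
    rw [zero_smul, add_zero] at h
    exact h
  have hM : IsUnit M.det := isUnit_iff_ne_zero.mpr hd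
  have h4 : (fun r : ℂ => (M + r • X).det) = fun r : ℂ => M.det * (1 + (M⁻¹ * X).trace * r +
      (Matrix.det (1 + (Polynomial.X : Polynomial ℂ) • (M⁻¹ * X).map Polynomial.C)).divX.divX.eval r * r ^ 2) := by
    funext r
    rw [← Matrix.det_one_add_smul, ← Matrix.det_mul, mul_add, mul_one, mul_smul_comm,
      Matrix.mul_nonsing_inv_cancel_left _ _ hM]
  have h5 : HasDerivAt (fun r : ℂ => M.det * (1 + (M⁻¹ * X).trace * r +
      (Matrix.det (1 + (Polynomial.X : Polynomial ℂ) • (M⁻¹ * X).map Polynomial.C)).divX.divX.eval r * r ^ 2))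
      (M.det * (M⁻¹ * X).trace) 0 := by
    set P := (Matrix.det (1 + (Polynomial.X : Polynomial ℂ) • (M⁻¹ * X).map Polynomial.C)).divX.divX
    have := ((((hasDerivAt_id (0:ℂ)).const_mul (M⁻¹ * X).trace).const_add 1).add
      ((P.hasDerivAt 0).mul ((hasDerivAt_id (0:ℂ)).pow 2))).const_mul M.det
    have e : (M.det *
      ((M⁻¹ * X).trace * 1 +
        (Polynomial.eval 0 (Polynomial.derivative P) * (id ^ 2 : ℂ → ℂ) 0 + Polynomial.eval 0 P *
          (((2 : ℕ) : ℂ) * id 0 ^ (2 - 1) * 1)))) = M.det * (M⁻¹ * X).trace := by simp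
    rw [e] at this
    exact this
  rw [h4] at h3
  exact h3.unique h5

theorem ringInv_hasFDerivAt {R : Type*} [NormedRing R] [NormedAlgebra ℂ R] [HasSummableGeomSeries R]
    {E : Type*} [NormedAddCommGroup E] [NormedSpace ℂ E] {a : E → R} {z : E}
    (ha : DifferentiableAt ℂ a z) (hd : IsUnit (a z)) (v : E) :
    DifferentiableAt ℂ (fun z => Ring.inverse (a z)) z ∧
    fderiv ℂ (fun z => Ring.inverse (a z)) z v =
      -(Ring.inverse (a z) * fderiv ℂ a z v * Ring.inverse (a z)) := by
  obtain ⟨u, hu⟩ := hd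
  have hr := hasFDerivAt_ringInverse (𝕜 := ℂ) u
  rw [hu] at hr
  have h1 := hr.comp z ha.hasFDerivAt
  refine ⟨h1.differentiableAt, ?_⟩
  have h4 : fderiv ℂ (fun z => Ring.inverse (a z)) z = _ := h1.fderiv
  rw [h4]
  have : (↑u⁻¹ : R) = Ring.inverse (a z) := by rw [← hu, Ring.inverse_unit]
  simp [this]

theorem inv_hasFDerivAt {ι : Type*} [Fintype ι] [DecidableEq ι]
    {E : Type*} [NormedAddCommGroup E] [NormedSpace ℂ E] {a : E → Matrix ι ι ℂ} {z : E}
    (ha : DifferentiableAt ℂ a z) (hd : (a z).det ≠ 0) (v : E) :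
    DifferentiableAt ℂ (fun z => (a z)⁻¹) z ∧
    fderiv ℂ (fun z => (a z)⁻¹) z v = -((a z)⁻¹ * fderiv ℂ a z v * (a z)⁻¹) := by
  have hM : IsUnit (a z) := (Matrix.isUnit_iff_isUnit_det _).mpr (isUnit_iff_ne_zero.mpr hd)
  simp only [Matrix.nonsing_inv_eq_ringInverse]
  exact ringInv_hasFDerivAt ha hM v

theorem entrywise {ι : Type*} [Fintype ι] [DecidableEq ι]
    {E : Type*} [NormedAddCommGroup E] [NormedSpace ℂ E] {a : E → Matrix ι ι ℂ} {z : E}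
    (ha : ∀ i j, DifferentiableAt ℂ (fun z => a z i j) z) (v : E) :
    DifferentiableAt ℂ a z ∧
    fderiv ℂ a z v = Matrix.of (fun i j => fderiv ℂ (fun z => a z i j) z v) := by
  have h0 : a = fun z => ∑ i, ∑ j, (a z i j) • (Matrix.single i j (1 : ℂ) : Matrix ι ι ℂ) := by
    funext z
    conv_lhs => rw [Matrix.matrix_eq_sum_single (a z)]
    simp [Matrix.smul_single]
  have hd : DifferentiableAt ℂ a z := by
    rw [h0]
    exact DifferentiableAt.fun_sum fun i _ => DifferentiableAt.fun_sum fun j _ =>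
      (ha i j).smul_const _
  refine ⟨hd, ?_⟩
  ext i j
  have h1 := (LinearMap.toContinuousLinearMap (Matrix.entryLinearMap ℂ ℂ i j)).hasFDerivAt.comp z
    hd.hasFDerivAt
  have h2 : fderiv ℂ (fun z => a z i j) z = _ := h1.fderiv
  show _ = fderiv ℂ (fun z => a z i j) z v
  rw [h2]; rfl

theorem det_entry {ι : Type*} [Fintype ι] [DecidableEq ι]
    {E : Type*} [NormedAddCommGroup E] [NormedSpace ℂ E] {a : E → Matrix ι ι ℂ} {z : E}
    (ha : ∀ i j, DifferentiableAt ℂ (fun z => a z i j) z) (hd : (a z).det ≠ 0) (v : E) :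
    DifferentiableAt ℂ (fun z => (a z).det) z ∧
    fderiv ℂ (fun z => (a z).det) z v = (a z).det *
      ((a z)⁻¹ * Matrix.of (fun i j => fderiv ℂ (fun z => a z i j) z v)).trace := by
  obtain ⟨h1, h2⟩ := entrywise ha v
  obtain ⟨h3, h4⟩ := det_hasFDerivAt h1 hd v
  exact ⟨h3, h2 ▸ h4⟩

theorem inv_entry {ι : Type*} [Fintype ι] [DecidableEq ι]
    {E : Type*} [NormedAddCommGroup E] [NormedSpace ℂ E] {a : E → Matrix ι ι ℂ} {z : E}
    (ha : ∀ i j, DifferentiableAt ℂ (fun z => a z i j) z) (hd : (a z).det ≠ 0) (v : E) (p q : ι) :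
    DifferentiableAt ℂ (fun z => (a z)⁻¹ p q) z ∧
    fderiv ℂ (fun z => (a z)⁻¹ p q) z v = (-((a z)⁻¹ *
      Matrix.of (fun i j => fderiv ℂ (fun z => a z i j) z v) * (a z)⁻¹)) p q := by
  obtain ⟨h1, h2⟩ := entrywise ha v
  obtain ⟨h3, h4⟩ := inv_hasFDerivAt h1 hd v
  have h5 := (LinearMap.toContinuousLinearMap (Matrix.entryLinearMap ℂ ℂ p q)).hasFDerivAt.comp z
    h3.hasFDerivAt
  refine ⟨h5.differentiableAt, ?_⟩
  have h6 : fderiv ℂ (fun z => (a z)⁻¹ p q) z = _ := h5.fderiv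
  rw [h6, ← h2, ← h4]; rfl

theorem det_contDiffAt {ι : Type*} [Fintype ι] [DecidableEq ι]
    {E : Type*} [NormedAddCommGroup E] [NormedSpace ℂ E] {a : E → Matrix ι ι ℂ} {z : E}
    (ha : ∀ i j, ContDiffAt ℂ ∞ (fun z => a z i j) z) :
    ContDiffAt ℂ ∞ (fun z => (a z).det) z := by
  simp only [Matrix.det_apply]
  exact ContDiffAt.sum fun σ _ => ContDiffAt.const_smul _ (contDiffAt_prod fun i _ => ha _ _)

theorem inv_contDiffAt {ι : Type*} [Fintype ι] [DecidableEq ι]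
    {E : Type*} [NormedAddCommGroup E] [NormedSpace ℂ E] {a : E → Matrix ι ι ℂ} {z : E}
    (ha : ∀ i j, ContDiffAt ℂ ∞ (fun z => a z i j) z) (hd : (a z).det ≠ 0) (p q : ι) :
    ContDiffAt ℂ ∞ (fun z => (a z)⁻¹ p q) z := by
  have : ∀ z, (a z)⁻¹ p q = ((a z).det)⁻¹ * ((a z).updateRow q (Pi.single p 1)).det := by
    intro z
    rw [Matrix.inv_def, Matrix.smul_apply, Ring.inverse_eq_inv', Matrix.adjugate_apply, smul_eq_mul]
  simp only [this]
  refine ((det_contDiffAt ha).inv hd).mul (det_contDiffAt fun i j => ?_)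
  by_cases h : i = q
  · subst h; simp only [Matrix.updateRow_self]; exact contDiffAt_const
  · simp only [Matrix.updateRow_ne h]; exact ha i j
end mcsec

section core
set_option linter.unusedSectionVars false
variable {R : Type*} [NormedRing R] [NormedAlgebra ℂ R] [CompleteSpace R]
  {ι : Type*} [Fintype ι] [DecidableEq ι]

/-- left invariant vector field -/
def Tv (X : R) (z : ℂ × R) : ℂ × R := (0, z.2 * X)
/-- parameter vector field -/
def T0 (_z : ℂ × R) : ℂ × R := (1, 0)

/-- coordinates are continuous -/
noncomputable def cor (bas : Module.Basis ι ℂ R) (j : ι) : R →L[ℂ] ℂ :=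
  haveI : FiniteDimensional ℂ R := bas.finiteDimensional_of_finite
  LinearMap.toContinuousLinearMap (bas.coord j)

theorem cor_apply (bas : Module.Basis ι ℂ R) (j : ι) (x : R) : cor bas j x = bas.repr x j := rfl

/-- the Jacobian matrix -/
noncomputable def aM (bas : Module.Basis ι ℂ R) (F : ℂ × R → R) (z : ℂ × R) :
    Matrix ι ι ℂ :=
  Matrix.of fun i j => cor bas j (lder F (Tv (bas i)) z)

/-- commutator bracket in coordinates -/
noncomputable def brk (bas : Module.Basis ι ℂ R) : (ι → ℂ) →ₗ[ℂ] (ι → ℂ) →ₗ[ℂ] (ι → ℂ) :=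
  LinearMap.mk₂ ℂ (fun v w => bas.equivFun (bas.equivFun.symm v * bas.equivFun.symm w -
      bas.equivFun.symm w * bas.equivFun.symm v))
    (by intro a b c; simp only [map_add, add_mul, mul_add, map_sub]; abel)
    (by intro a b c; simp only [map_smul, smul_mul_assoc, mul_smul_comm, map_sub, smul_sub])
    (by intro a b c; simp only [map_add, add_mul, mul_add, map_sub]; abel)
    (by intro a b c; simp only [map_smul, smul_mul_assoc, mul_smul_comm, map_sub, smul_sub])

theorem brk_apply (bas : Module.Basis ι ℂ R) (v w : ι → ℂ) :
    brk bas v w = bas.equivFun (bas.equivFun.symm v * bas.equivFun.symm w -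
      bas.equivFun.symm w * bas.equivFun.symm v) := rfl

theorem bas_single (bas : Module.Basis ι ℂ R) (i : ι) :
    bas.equivFun.symm (Pi.single i 1) = bas i := by
  rw [LinearEquiv.symm_apply_eq]
  ext j
  rw [bas.equivFun_self, Pi.single_apply]
  simp [eq_comm]

theorem bas_lder (bas : Module.Basis ι ℂ R) (x : R) :
    bas.equivFun.symm (fun j => cor bas j x) = x := by
  rw [LinearEquiv.symm_apply_eq]; rfl

theorem Tv_contDiff (X : R) : ContDiff ℂ ∞ (Tv X) :=
  contDiff_const.prodMk (contDiff_snd.mul contDiff_const)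

theorem Tv_fderiv (X : R) (z v : ℂ × R) :
    fderiv ℂ (Tv X) z v = (0, v.2 * X) := by
  have h : HasFDerivAt (Tv X) ((0 : (ℂ × R) →L[ℂ] ℂ).prod
     (((ContinuousLinearMap.mul ℂ R).flip X).comp
      (ContinuousLinearMap.snd ℂ ℂ R))) z :=
    (hasFDerivAt_const _ _).prodMk (((ContinuousLinearMap.mul ℂ R).flip X).comp
      (ContinuousLinearMap.snd ℂ ℂ R)).hasFDerivAt
  rw [h.fderiv]; rfl

theorem cor_contDiffAt (bas : Module.Basis ι ℂ R) {g : ℂ × R → R} {z : ℂ × R}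
    (hg : ContDiffAt ℂ ∞ g z) (j : ι) : ContDiffAt ℂ ∞ (fun z => cor bas j (g z)) z :=
  (cor bas j).contDiff.contDiffAt.comp z hg

theorem cor_fderiv (bas : Module.Basis ι ℂ R) {g : ℂ × R → R} {z : ℂ × R}
    (hg : ContDiffAt ℂ ∞ g z) (j : ι) (v : ℂ × R) :
    fderiv ℂ (fun z => cor bas j (g z)) z v = cor bas j (fderiv ℂ g z v) := by
  have h1 := (cor bas j).hasFDerivAt.comp z (hg.differentiableAt (by simp)).hasFDerivAt
  have h2 : fderiv ℂ (fun z => cor bas j (g z)) z = _ := h1.fderiv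
  rw [h2]; rfl

theorem aM_contDiffAt (bas : Module.Basis ι ℂ R) {F : ℂ × R → R} {z : ℂ × R}
    (hF : ContDiffAt ℂ ∞ F z) (hu : IsUnit (F z)) (i j : ι) :
    ContDiffAt ℂ ∞ (fun z => aM bas F z i j) z :=
  cor_contDiffAt bas (lder_contDiffAt hF hu (Tv_contDiff (bas i)).contDiffAt) j

theorem aM_fderiv (bas : Module.Basis ι ℂ R) {F : ℂ × R → R} {z : ℂ × R}
    (hF : ContDiffAt ℂ ∞ F z) (hu : IsUnit (F z)) (v : ℂ × R) (i j : ι) :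
    fderiv ℂ (fun z => aM bas F z i j) z v = cor bas j (fderiv ℂ (lder F (Tv (bas i))) z v) :=
  cor_fderiv bas (lder_contDiffAt hF hu (Tv_contDiff (bas i)).contDiffAt) j v

/-- the vector field whose divergence we take -/
noncomputable def Vf (bas : Module.Basis ι ℂ R) (ψ : R → ℂ) (F : ℂ × R → R) (i : ι)
    (z : ℂ × R) : ℂ :=
  ∑ j, ψ (F z) * (aM bas F z).det * (aM bas F z)⁻¹ j i * cor bas j (lder F T0 z)

theorem Vf_contDiffAt (bas : Module.Basis ι ℂ R) {F : ℂ × R → R} {z : ℂ × R} {ψ : R → ℂ}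
    (hF : ContDiffAt ℂ ∞ F z) (hu : IsUnit (F z)) (hψ : ContDiffAt ℂ ∞ ψ (F z))
    (hd : (aM bas F z).det ≠ 0) (i : ι) : ContDiffAt ℂ ∞ (Vf bas ψ F i) z := by
  have ha := aM_contDiffAt bas hF hu
  have hB0 : ContDiffAt ℂ ∞ (lder F T0) z := lder_contDiffAt hF hu contDiffAt_const
  exact ContDiffAt.sum fun j _ => (((hψ.comp z hF).mul (det_contDiffAt ha)).mul
    (inv_contDiffAt ha hd j i)).mul (cor_contDiffAt bas hB0 j)

theorem core (bas : Module.Basis ι ℂ R)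
    (hun : ∀ v : R, ∑ p, bas.repr (v * bas p - bas p * v) p = 0)
    {F : ℂ × R → R} {z : ℂ × R} {ψ : R → ℂ}
    (hF : ContDiffAt ℂ ∞ F z) (hu : IsUnit (F z)) (hψ : ContDiffAt ℂ ∞ ψ (F z))
    (hd : (aM bas F z).det ≠ 0) :
    fderiv ℂ (fun z => ψ (F z) * (aM bas F z).det) z (T0 z) =
      ∑ i, fderiv ℂ (Vf bas ψ F i) z (Tv (bas i) z) := by
  have haD : ∀ i j, DifferentiableAt ℂ (fun z => aM bas F z i j) z :=
    fun i j => (aM_contDiffAt bas hF hu i j).differentiableAt (by simp)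
  have hdet := det_entry haD hd
  have hinv := inv_entry haD hd
  have hFD := hF.differentiableAt (by simp)
  have hψD := hψ.differentiableAt (by simp)
  have hΦ : DifferentiableAt ℂ (fun z => ψ (F z)) z := hψD.comp z hFD
  have hΦ' : ∀ v, fderiv ℂ (fun z => ψ (F z)) z v = fderiv ℂ ψ (F z) (fderiv ℂ F z v) := by
    intro v
    have : fderiv ℂ (fun z => ψ (F z)) z = _ := fderiv_comp z hψD hFD
    rw [this]; rfl
  have hB0 : ContDiffAt ℂ ∞ (lder F T0) z := lder_contDiffAt hF hu contDiffAt_const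
  have hFi : ∀ V : ℂ × R → ℂ × R, F z * lder F V z = fderiv ℂ F z (V z) := by
    intro V
    simp only [lder]
    rw [← mul_assoc, Ring.mul_inverse_cancel _ hu, one_mul]
  -- derivative of Vf
  have hV : ∀ i v, fderiv ℂ (Vf bas ψ F i) z v = ∑ j,
      (fderiv ℂ (fun z => ψ (F z)) z v * (aM bas F z).det * (aM bas F z)⁻¹ j i * cor bas j (lder F T0 z)
      + ψ (F z) * ((aM bas F z).det * ((aM bas F z)⁻¹ *
        Matrix.of (fun i j => fderiv ℂ (fun z => aM bas F z i j) z v)).trace) * (aM bas F z)⁻¹ j i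
        * cor bas j (lder F T0 z)
      + ψ (F z) * (aM bas F z).det * (-((aM bas F z)⁻¹ *
        Matrix.of (fun i j => fderiv ℂ (fun z => aM bas F z i j) z v) * (aM bas F z)⁻¹)) j i
        * cor bas j (lder F T0 z)
      + ψ (F z) * (aM bas F z).det * (aM bas F z)⁻¹ j i * cor bas j (fderiv ℂ (lder F T0) z v)) := by
    intro i v
    have hj : ∀ j, HasFDerivAt (fun z => ψ (F z) * (aM bas F z).det * (aM bas F z)⁻¹ j i * cor bas j (lder F T0 z))
        _ z := fun j =>
      (((hΦ.hasFDerivAt.mul (hdet v).1.hasFDerivAt).mul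
        (hinv v j i).1.hasFDerivAt).mul
        ((cor_contDiffAt bas hB0 j).differentiableAt (by simp)).hasFDerivAt)
    have hs := HasFDerivAt.fun_sum (u := Finset.univ) fun j _ => hj j
    have hs' : fderiv ℂ (Vf bas ψ F i) z = _ := hs.fderiv
    rw [hs', _root_.sum_apply]
    refine Finset.sum_congr rfl fun j _ => ?_
    rw [← (hdet v).2, ← (hinv v j i).2, ← cor_fderiv bas hB0]
    simp only [_root_.add_apply, _root_.smul_apply, smul_eq_mul, Pi.mul_apply]
    ring
  have hL : fderiv ℂ (fun z => ψ (F z) * (aM bas F z).det) z (T0 z) =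
     fderiv ℂ (fun z => ψ (F z)) z (T0 z) * (aM bas F z).det
      + ψ (F z) * ((aM bas F z).det * ((aM bas F z)⁻¹ *
        Matrix.of (fun i j => fderiv ℂ (fun z => aM bas F z i j) z (T0 z))).trace) := by
    have h := (hΦ.hasFDerivAt.mul (hdet (T0 z)).1.hasFDerivAt)
    have h' : fderiv ℂ (fun z => ψ (F z) * (aM bas F z).det) z = _ := h.fderiv
    rw [h', ← (hdet (T0 z)).2]
    simp only [_root_.add_apply, _root_.smul_apply, smul_eq_mul]
    ring
  rw [hL]
  simp only [hV]
  have hdu : IsUnit (aM bas F z).det := isUnit_iff_ne_zero.mpr hd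
  refine alg_core (brk bas) (fun v w => ?_) (fun v => ?_) (aM bas F z) (aM bas F z)⁻¹
    (Matrix.nonsing_inv_mul _ hdu) (Matrix.mul_nonsing_inv _ hdu)
    (fun k => Matrix.of (fun i j => fderiv ℂ (fun z => aM bas F z i j) z (Tv (bas k) z)))
    (Matrix.of (fun i j => fderiv ℂ (fun z => aM bas F z i j) z (T0 z)))
    (fun j => cor bas j (lder F T0 z)) (fun i j => cor bas j (fderiv ℂ (lder F T0) z (Tv (bas i) z)))
    (ψ (F z)) (aM bas F z).det _ (fun i => fderiv ℂ (fun z => ψ (F z)) z (Tv (bas i) z))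
    ((fderiv ℂ ψ (F z)).toLinearMap ∘ₗ (LinearMap.mulLeft ℂ (F z)) ∘ₗ bas.equivFun.symm.toLinearMap) ?_ ?_ ?_ ?_
  · rw [brk_apply, brk_apply, ← map_neg, neg_sub]
  · simp only [brk_apply, bas_single]
    exact hun _
  · intro i q p
    simp only [Matrix.of_apply]
    rw [aM_fderiv bas hF hu, aM_fderiv bas hF hu, ← map_sub,
      lder_comm hF hu (Tv_contDiff (bas i)).contDiffAt (Tv_contDiff (bas q)).contDiffAt,
      map_sub, Tv_fderiv, Tv_fderiv]
    congr 1
    · have : ((0, (Tv (bas i) z).2 * bas q) - (0, (Tv (bas q) z).2 * bas i) : ℂ × R) =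
         ∑ l, (brk bas (Pi.single i 1) (Pi.single q 1) l) • Tv (bas l) z := by
        have h2 : (bas i * bas q - bas q * bas i : R) =
            ∑ l, (brk bas (Pi.single i 1) (Pi.single q 1) l) • bas l := by
          simp only [brk_apply, bas_single]
          exact (bas.sum_equivFun _).symm
        ext1
        · simp [Tv, Prod.fst_sum]
        · simp only [Tv, Prod.snd_sub, Prod.snd_sum, Prod.smul_snd, mul_assoc, ← mul_sub, h2,
            Finset.mul_sum, mul_smul_comm]
      rw [this, map_sum, Finset.mul_sum, map_sum]
      refine Finset.sum_congr rfl fun l _ => ?_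
      rw [map_smul, mul_smul_comm, map_smul, smul_eq_mul]
      rfl
    · have e : ∀ i, bas.equivFun.symm (aM bas F z i) = lder F (Tv (bas i)) z := fun i => bas_lder bas _
      rw [brk_apply, e, e]; rfl
  · intro q p
    simp only [Matrix.of_apply]
    rw [aM_fderiv bas hF hu]
    have h := lder_comm hF hu (V := T0) (W := Tv (bas q)) contDiffAt_const
      (Tv_contDiff (bas q)).contDiffAt
    have e1 : fderiv ℂ (Tv (bas q)) z (T0 z) = 0 := by
      rw [Tv_fderiv]; simp [T0]
    have e2 : fderiv ℂ (T0 : ℂ × R → _) z = 0 := fderiv_const_apply _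
    rw [e1, e2] at h
    simp only [_root_.zero_apply, sub_zero, map_zero, mul_zero, zero_sub, neg_sub] at h
    rw [sub_eq_iff_eq_add] at h
    have e : ∀ i, bas.equivFun.symm (aM bas F z i) = lder F (Tv (bas i)) z := fun i => bas_lder bas _
    rw [h, add_comm, map_add, brk_apply, e, bas_lder]
    rfl
  · intro i
    have e : ∀ i, bas.equivFun.symm (aM bas F z i) = lder F (Tv (bas i)) z := fun i => bas_lder bas _
    simp only [LinearMap.comp_apply, LinearEquiv.coe_coe]
    rw [hΦ', ← hFi, e]
    rfl
  · simp only [LinearMap.comp_apply, LinearEquiv.coe_coe]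
    rw [hΦ', ← hFi, bas_lder]
    rfl
end core

open MeasureTheory Filter Topology in
theorem param_int {𝕜 : Type*} [RCLike 𝕜] {K : Type*} [TopologicalSpace K] [CompactSpace K]
    [MeasurableSpace K]
    [OpensMeasurableSpace K] (μ : Measure K) [IsFiniteMeasure μ] {S : Set 𝕜} (hS : IsOpen S)
    {E : Type*} [NormedAddCommGroup E] [NormedSpace 𝕜 E] [NormedSpace ℝ E] [SecondCountableTopology E]
    {H H' : 𝕜 → K → E}
    (hd : ∀ s ∈ S, ∀ u, HasDerivAt (fun s => H s u) (H' s u) s)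
    (hc : ∀ s ∈ S, Continuous (H s))
    (hc' : ContinuousOn (Function.uncurry H') (S ×ˢ Set.univ)) (s : 𝕜) (hs : s ∈ S) :
    HasDerivAt (fun s => ∫ u, H s u ∂μ) (∫ u, H' s u ∂μ) s := by
  obtain ⟨ε, hε, hb⟩ := Metric.nhds_basis_closedBall.mem_iff.mp (hS.mem_nhds hs)
  have hcomp : IsCompact (Metric.closedBall s ε ×ˢ (Set.univ : Set K)) :=
    (isCompact_closedBall s ε).prod isCompact_univ
  obtain ⟨C, hC⟩ := hcomp.exists_bound_of_continuousOn
    (hc'.mono (Set.prod_mono hb subset_rfl))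
  have hint : ∀ s ∈ S, Continuous (H' s) := by
    intro s hs
    have := hc'.comp_continuous (f := fun u : K => (s, u)) (by fun_prop) (fun u => ⟨hs, trivial⟩)
    exact this
  refine (hasDerivAt_integral_of_dominated_loc_of_deriv_le (μ := μ) (F := H) (F' := H')
    (bound := fun _ => C) (Metric.closedBall_mem_nhds s hε) ?_ ?_ ?_ ?_ ?_ ?_).2
  · filter_upwards [hS.mem_nhds hs] with x hx
    exact (hc x hx).aestronglyMeasurable
  · exact (hc s hs).integrable_of_hasCompactSupport (HasCompactSupport.of_compactSpace _)
  · exact (hint s hs).aestronglyMeasurable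
  · exact ae_of_all _ fun u x hx => hC (x, u) ⟨hx, trivial⟩
  · exact integrable_const C
  · exact ae_of_all _ fun u x hx => hd x (hb hx) u

section constancy
open MeasureTheory Filter Topology
variable {R : Type*} [NormedRing R] [NormedAlgebra ℂ R] [CompleteSpace R]
  {ι : Type*} [Fintype ι] [DecidableEq ι]

theorem aM_zero (bas : Module.Basis ι ℂ R) {F : ℂ × R → R} {x : R} (hx : IsUnit x)
    (hF : DifferentiableAt ℂ F (0, x)) (h0 : ∀ x, IsUnit x → F (0, x) = x) :
    aM bas F (0, x) = 1 := by
  have hh : ∀ X, lder F (Tv X) (0, x) = X := by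
    intro X
    have h1 : HasFDerivAt (fun y : R => ((0 : ℂ), y)) (ContinuousLinearMap.inr ℂ ℂ R) x :=
      hasFDerivAt_prodMk_right 0 x
    have h2 := hF.hasFDerivAt.comp x h1
    have h3 : (F ∘ fun y : R => ((0 : ℂ), y)) =ᶠ[𝓝 x] id := by
      filter_upwards [Units.isOpen.mem_nhds hx] with y hy using h0 y hy
    have h4 := (h2.congr_of_eventuallyEq h3.symm).unique (hasFDerivAt_id x)
    have h5 := congrArg (fun f => f (x * X)) h4
    simp only [ContinuousLinearMap.comp_apply, ContinuousLinearMap.inr_apply,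
      ContinuousLinearMap.id_apply] at h5
    simp only [lder, Tv]
    rw [h5, h0 x hx, ← mul_assoc, Ring.inverse_mul_cancel _ hx, one_mul]
  ext i j
  simp only [aM, Matrix.of_apply, hh, cor_apply, bas.repr_self, Matrix.one_apply,
    Finsupp.single_apply]

theorem constancy (bas : Module.Basis ι ℂ R)
    (hun : ∀ v : R, ∑ p, bas.repr (v * bas p - bas p * v) p = 0)
    {K : Type*} [TopologicalSpace K] [CompactSpace K]
    [MeasurableSpace K] [OpensMeasurableSpace K] (μ : Measure K) [IsFiniteMeasure μ]
    (j : K → R) (hj : Continuous j) (hju : ∀ u, IsUnit (j u))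
    (hH : ∀ Ψ : R → ℂ, (∀ u, ContDiffAt ℂ ∞ Ψ (j u)) → ∀ X,
      ∫ u, fderiv ℂ Ψ (j u) (j u * X) ∂μ = 0)
    {S : Set ℂ} (hS : IsOpen S) (hSc : IsPreconnected S) (hS0 : 0 ∈ S) (hS1 : 1 ∈ S)
    {F : ℂ × R → R} (hF : ∀ z : ℂ × R, z.1 ∈ S → IsUnit z.2 → ContDiffAt ℂ ∞ F z ∧ IsUnit (F z))
    (h0 : ∀ x, IsUnit x → F (0, x) = x)
    {ψ : R → ℂ} (hψ : ∀ x, IsUnit x → ContDiffAt ℂ ∞ ψ x) :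
    ∫ u, ψ (F (1, j u)) * (aM bas F (1, j u)).det ∂μ = ∫ u, ψ (j u) ∂μ := by
  set G : ℂ × R → ℂ := fun z => ψ (F z) * (aM bas F z).det with hGdef
  have hG : ∀ z : ℂ × R, z.1 ∈ S → IsUnit z.2 → ContDiffAt ℂ ∞ G z := fun z h1 h2 =>
    ((hψ _ (hF z h1 h2).2).comp z (hF z h1 h2).1).mul
      (det_contDiffAt (aM_contDiffAt bas (hF z h1 h2).1 (hF z h1 h2).2))
  set h : ℂ → ℂ := fun s => ∫ u, G (s, j u) ∂μ with hh
  have hder : ∀ s ∈ S, HasDerivAt h (∫ u, fderiv ℂ G (s, j u) (1, 0) ∂μ) s := by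
    refine param_int μ hS (H := fun s u => G (s, j u))
      (H' := fun s u => fderiv ℂ G (s, j u) (1, 0)) ?_ ?_ ?_
    · intro s hs u
      have h1 := ((hG (s, j u) hs (hju u)).differentiableAt (by simp)).hasFDerivAt
      have h2 : HasDerivAt (fun s : ℂ => (s, j u)) (1, 0) s :=
        (hasDerivAt_id s).prodMk (hasDerivAt_const s _)
      exact h1.comp_hasDerivAt s h2
    · intro s hs
      rw [continuous_iff_continuousAt]
      intro u
      have h1 : ContinuousAt G (s, j u) := (hG (s, j u) hs (hju u)).continuousAt
      exact ContinuousAt.comp (f := fun u => (s, j u)) h1 (by fun_prop)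
    · rintro ⟨s, u⟩ ⟨hs, -⟩
      have h1 : ContinuousAt (fderiv ℂ G) (s, j u) :=
        ((hG (s, j u) hs (hju u)).fderiv_right (m := ∞) (by simp)).continuousAt
      have h2 : ContinuousAt (fun p : ℂ × K => fderiv ℂ G (p.1, j p.2)) (s, u) :=
        ContinuousAt.comp (f := fun p : ℂ × K => (p.1, j p.2)) h1 (by fun_prop)
      exact (h2.clm_apply continuousAt_const).continuousWithinAt
  have hdiff : DifferentiableOn ℂ h S := fun s hs => (hder s hs).differentiableAt.differentiableWithinAt
  have hev : ∀ᶠ s in 𝓝 (0 : ℂ), ∀ u ∈ (Set.univ : Set K), (aM bas F (s, j u)).det ≠ 0 := by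
    refine isCompact_univ.eventually_forall_of_forall_eventually fun u _ => ?_
    have hz := hF (0, j u) hS0 (hju u)
    have h1 : ContinuousAt (fun z => (aM bas F z).det) (0, j u) :=
      (det_contDiffAt (aM_contDiffAt bas hz.1 hz.2)).continuousAt
    have h2 : ContinuousAt (fun p : ℂ × K => (aM bas F (p.1, j p.2)).det) (0, u) :=
      ContinuousAt.comp (x := ((0 : ℂ), u)) (g := fun z => (aM bas F z).det)
        (f := fun p : ℂ × K => (p.1, j p.2)) h1 (by fun_prop)
    refine h2.eventually_ne ?_
    simp only
    rw [aM_zero bas (hju u) (hz.1.differentiableAt (by simp)) h0, Matrix.det_one]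
    exact one_ne_zero
  have hz : ∀ᶠ s in 𝓝 (0 : ℂ), deriv h s = 0 := by
    filter_upwards [hev, hS.mem_nhds hS0] with s hs hsS
    rw [(hder s hsS).deriv]
    have hVs : ∀ i u, ContDiffAt ℂ ∞ (Vf bas ψ F i) (s, j u) := fun i u => by
      have hz := hF (s, j u) hsS (hju u)
      exact Vf_contDiffAt bas hz.1 hz.2 (hψ _ hz.2) (hs u trivial) i
    have hΨ : ∀ i u, ContDiffAt ℂ ∞ (fun x => Vf bas ψ F i (s, x)) (j u) := fun i u =>
      (hVs i u).comp (f := fun x : R => (s, x)) (j u) (contDiffAt_const.prodMk contDiffAt_id)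
    have hchain : ∀ i u, fderiv ℂ (Vf bas ψ F i) (s, j u) (Tv (bas i) (s, j u)) =
        fderiv ℂ (fun x => Vf bas ψ F i (s, x)) (j u) (j u * bas i) := by
      intro i u
      have h1 : HasFDerivAt (fun y : R => (s, y)) (ContinuousLinearMap.inr ℂ ℂ R) (j u) :=
        hasFDerivAt_prodMk_right s (j u)
      have h2 := ((hVs i u).differentiableAt (by simp)).hasFDerivAt.comp (j u) h1
      have h3 : fderiv ℂ (fun x => Vf bas ψ F i (s, x)) (j u) = _ := h2.fderiv
      rw [h3]; rfl
    have hcore : ∀ u, fderiv ℂ G (s, j u) (1, 0) =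
        ∑ i, fderiv ℂ (fun x => Vf bas ψ F i (s, x)) (j u) (j u * bas i) := by
      intro u
      have hz := hF (s, j u) hsS (hju u)
      have := core bas hun hz.1 hz.2 (hψ _ hz.2) (hs u trivial)
      simp only [hchain] at this
      exact this
    simp only [hcore]
    rw [integral_finsetSum]
    · exact Finset.sum_eq_zero fun i _ => hH _ (hΨ i) _
    · intro i _
      refine Continuous.integrable_of_hasCompactSupport ?_ (HasCompactSupport.of_compactSpace _)
      rw [continuous_iff_continuousAt]
      intro u
      have h1 : ContinuousAt (fderiv ℂ (fun x => Vf bas ψ F i (s, x))) (j u) :=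
        ((hΨ i u).fderiv_right (m := ∞) (by simp)).continuousAt
      have h2 : ContinuousAt (fun u => fderiv ℂ (fun x => Vf bas ψ F i (s, x)) (j u)) u :=
        ContinuousAt.comp (f := j) h1 hj.continuousAt
      exact h2.clm_apply (by fun_prop)
  have han : AnalyticOnNhd ℂ (deriv h) S := (hdiff.analyticOnNhd hS).deriv
  have hzero := han.eqOn_zero_of_preconnected_of_eventuallyEq_zero hSc hS0 hz
  have hfin := hS.is_const_of_deriv_eq_zero hSc hdiff hzero hS1 hS0
  rw [hh] at hfin
  simp only at hfin
  rw [hGdef] at hfin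
  simp only at hfin
  rw [hfin]
  refine integral_congr_ae (ae_of_all _ fun u => ?_)
  simp only
  have hz := hF (0, j u) hS0 (hju u)
  rw [aM_zero bas (hju u) (hz.1.differentiableAt (by simp)) h0, Matrix.det_one, h0 _ (hju u), mul_one]
end constancy

section haarlem
set_option linter.unusedSectionVars false
open MeasureTheory Filter Topology
variable {R : Type*} [NormedRing R] [NormedAlgebra ℂ R] [CompleteSpace R] [StarRing R] [CStarRing R]
  [StarModule ℂ R] [FiniteDimensional ℂ R]

theorem compact_unitary : CompactSpace (unitary R) := by
  have : ProperSpace R := FiniteDimensional.proper ℂ R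
  refine isCompact_iff_compactSpace.mp (?_ : IsCompact (unitary R : Set R))
  refine Metric.isCompact_of_isClosed_isBounded isClosed_unitary ?_
  refine (Metric.isBounded_closedBall (x := (0 : R)) (r := 1)).subset fun u hu => ?_
  rw [mem_closedBall_zero_iff]
  rcases subsingleton_or_nontrivial R with h | h
  · rw [Subsingleton.elim u 0]; simp
  · exact (CStarRing.norm_of_mem_unitary hu).le

theorem isUnit_unitary (u : unitary R) : IsUnit (u : R) := ⟨Unitary.toUnits u, rfl⟩

theorem haar_sa [MeasurableSpace (unitary R)] [BorelSpace (unitary R)] (μ : Measure (unitary R))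
    [IsFiniteMeasure μ] [μ.IsMulRightInvariant] (Ψ : R → ℂ)
    (hΨ : ∀ u : unitary R, ContDiffAt ℂ ∞ Ψ u) (a : selfAdjoint R) :
    ∫ u : unitary R, fderiv ℂ Ψ u (u * (Complex.I • (a : R))) ∂μ = 0 := by
  have : CompactSpace (unitary R) := compact_unitary
  set X : R := Complex.I • (a : R) with hX
  have hexp : ∀ ε : ℝ, ((selfAdjoint.expUnitary (ε • a) : unitary R) : R) =
      NormedSpace.exp ((ε : ℂ) • X) := by
    intro ε
    rw [selfAdjoint.expUnitary_coe, hX, smul_comm]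
    congr 1
  have hcE : Continuous fun s : ℂ => NormedSpace.exp (s • X) := by
    rw [continuous_iff_continuousAt]
    exact fun s => (hasDerivAt_exp_smul_const (𝕂 := ℂ) X s).continuousAt
  have hcF : ∀ ε : ℝ, ∀ u : unitary R, ContinuousAt (fderiv ℂ Ψ) (u * NormedSpace.exp ((ε : ℂ) • X)) := by
    intro ε u
    rw [← hexp]
    exact ((hΨ (u * selfAdjoint.expUnitary (ε • a))).fderiv_right (m := ∞) (by simp)).continuousAt
  have key := param_int (𝕜 := ℝ) μ isOpen_univ
    (H := fun ε u => Ψ (u * NormedSpace.exp ((ε : ℂ) • X)))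
    (H' := fun ε u => fderiv ℂ Ψ (u * NormedSpace.exp ((ε : ℂ) • X))
      (u * (NormedSpace.exp ((ε : ℂ) • X) * X))) ?_ ?_ ?_ 0 trivial
  · have hconst : (fun ε : ℝ => ∫ u : unitary R, Ψ (u * NormedSpace.exp ((ε : ℂ) • X)) ∂μ) =
        fun _ => ∫ u : unitary R, Ψ u ∂μ := by
      funext ε
      rw [← hexp]
      exact integral_mul_right_eq_self (fun u : unitary R => Ψ u) (selfAdjoint.expUnitary (ε • a))
    rw [hconst] at key
    have := key.unique (hasDerivAt_const _ _)
    simpa using this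
  · intro ε _ u
    have h1 : HasDerivAt (fun s : ℂ => Ψ (u * NormedSpace.exp (s • X)))
        (fderiv ℂ Ψ (u * NormedSpace.exp ((ε : ℂ) • X))
          (u * (NormedSpace.exp ((ε : ℂ) • X) * X))) (ε : ℂ) := by
      have hd : HasFDerivAt Ψ (fderiv ℂ Ψ (u * NormedSpace.exp ((ε : ℂ) • X)))
          (u * NormedSpace.exp ((ε : ℂ) • X)) := by
        rw [← hexp]
        exact ((hΨ (u * selfAdjoint.expUnitary (ε • a))).differentiableAt (by simp)).hasFDerivAt
      exact hd.comp_hasDerivAt (ε : ℂ) ((hasDerivAt_exp_smul_const (𝕂 := ℂ) X (ε : ℂ)).const_mul (u : R))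
    exact h1.comp_ofReal
  · intro ε _
    rw [continuous_iff_continuousAt]
    intro u
    have h1 : ContinuousAt Ψ (u * NormedSpace.exp ((ε : ℂ) • X)) := by
      rw [← hexp]
      exact (hΨ (u * selfAdjoint.expUnitary (ε • a))).continuousAt
    exact ContinuousAt.comp (x := u) (g := Ψ) (f := fun u : unitary R => (u : R) * NormedSpace.exp ((ε : ℂ) • X))
      h1 (by fun_prop)
  · rintro ⟨ε, u⟩ -
    have hc0 : Continuous fun p : ℝ × unitary R => NormedSpace.exp ((p.1 : ℂ) • X) :=
      hcE.comp (f := fun p : ℝ × unitary R => (p.1 : ℂ)) (by fun_prop)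
    have h2 : ContinuousAt (fun p : ℝ × unitary R => fderiv ℂ Ψ (p.2 * NormedSpace.exp ((p.1 : ℂ) • X))) (ε, u) :=
      ContinuousAt.comp (x := (ε, u)) (g := fderiv ℂ Ψ)
        (f := fun p : ℝ × unitary R => (p.2 : R) * NormedSpace.exp ((p.1 : ℂ) • X))
        (hcF ε u) (by fun_prop)
    exact (h2.clm_apply (by fun_prop)).continuousWithinAt

theorem haar_all [MeasurableSpace (unitary R)] [BorelSpace (unitary R)] (μ : Measure (unitary R))
    [IsFiniteMeasure μ] [μ.IsMulRightInvariant] (Ψ : R → ℂ)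
    (hΨ : ∀ u : unitary R, ContDiffAt ℂ ∞ Ψ u) (X : R) :
    ∫ u : unitary R, fderiv ℂ Ψ u (u * X) ∂μ = 0 := by
  have : CompactSpace (unitary R) := compact_unitary
  have h1 := haar_sa μ Ψ hΨ (realPart X)
  have h2 := haar_sa μ Ψ hΨ (imaginaryPart X)
  have hint : ∀ Y : R, Integrable (fun u : unitary R => fderiv ℂ Ψ u (u * Y)) μ := by
    intro Y
    refine Continuous.integrable_of_hasCompactSupport ?_ (HasCompactSupport.of_compactSpace _)
    rw [continuous_iff_continuousAt]
    intro u
    have h1 : ContinuousAt (fderiv ℂ Ψ) u :=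
      ((hΨ u).fderiv_right (m := ∞) (by simp)).continuousAt
    have h2 : ContinuousAt (fun u : unitary R => fderiv ℂ Ψ u) u :=
      ContinuousAt.comp (x := u) (g := fderiv ℂ Ψ) (f := fun u : unitary R => (u : R)) h1 (by fun_prop)
    exact h2.clm_apply (by fun_prop)
  have hX := realPart_add_I_smul_imaginaryPart X
  have e : ∀ u : unitary R, fderiv ℂ Ψ u (u * X) =
      -Complex.I * fderiv ℂ Ψ u (u * (Complex.I • (realPart X : R))) +
        fderiv ℂ Ψ u (u * (Complex.I • (imaginaryPart X : R))) := by
    intro u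
    conv_lhs => rw [← hX]
    rw [mul_add, map_add, mul_smul_comm _ _ (realPart X : R), map_smul, smul_eq_mul, ← mul_assoc]
    simp
  simp only [e]
  rw [integral_add ((hint _).const_mul _) (hint _), integral_const_mul, h1, h2]
  simp
end haarlem

section degree
open MeasureTheory Filter Topology
variable {R : Type*} [NormedRing R] [NormedAlgebra ℂ R] [CompleteSpace R] [StarRing R] [CStarRing R]
  [StarModule ℂ R] [FiniteDimensional ℂ R] {ι : Type*} [Fintype ι] [DecidableEq ι]

theorem degree (bas : Module.Basis ι ℂ R)
    (hun : ∀ v : R, ∑ p, bas.repr (v * bas p - bas p * v) p = 0)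
    (φ : R → ℂ) (hφ : ∀ x, IsUnit x → ContDiffAt ℂ ∞ φ x) (hφ1 : φ 1 = 1)
    (r : unitary R → ℝ) (hr : ∀ u : unitary R, φ u = r u) (hr0 : ∀ u, 0 ≤ r u)
    (hr1 : ∀ u, r u ≤ 1) (hre : ∀ u, r u = 1 → u = 1)
    {S : Set ℂ} (hS : IsOpen S) (hSc : IsPreconnected S) (hS0 : 0 ∈ S) (hS1 : 1 ∈ S)
    {F : ℂ × R → R} (hF : ∀ z : ℂ × R, z.1 ∈ S → IsUnit z.2 → ContDiffAt ℂ ∞ F z ∧ IsUnit (F z))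
    (h0 : ∀ x, IsUnit x → F (0, x) = x)
    (f : unitary R → unitary R) (hf : ∀ u : unitary R, F (1, u) = f u) :
    ∃ u : unitary R, f u = 1 := by
  have hK : CompactSpace (unitary R) := compact_unitary
  let _ : MeasurableSpace (unitary R) := borel _
  have hB : BorelSpace (unitary R) := ⟨rfl⟩
  set μ : Measure (unitary R) := (Measure.haar : Measure (unitary R)).inv
  have hfin : IsFiniteMeasure μ := inferInstance
  have hopen : μ.IsOpenPosMeasure := inferInstance
  have hinv : μ.IsMulRightInvariant := inferInstance
  have hc : ∀ N : ℕ, ∫ u : unitary R, (φ (F (1, u))) ^ N * (aM bas F (1, u)).det ∂μ =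
      ∫ u : unitary R, (φ u) ^ N ∂μ := fun N =>
    constancy bas hun μ (fun u : unitary R => (u : R)) continuous_subtype_val isUnit_unitary
      (haar_all μ) hS hSc hS0 hS1 hF h0 (ψ := fun x => φ x ^ N) (fun x hx => (hφ x hx).pow N)
  by_contra! hne
  have hrc : Continuous r := by
    have : r = fun u : unitary R => (φ u).re := by funext u; rw [hr]; simp
    rw [this, continuous_iff_continuousAt]
    intro u
    exact Complex.continuous_re.continuousAt.comp
      (ContinuousAt.comp (x := u) (g := φ) (f := fun u : unitary R => (u : R))
      (hφ _ (isUnit_unitary u)).continuousAt (by fun_prop))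
  have hfc : Continuous f := by
    rw [continuous_induced_rng, continuous_iff_continuousAt]
    intro u
    have h1 : ContinuousAt F (1, (u : R)) := (hF (1, u) hS1 (isUnit_unitary u)).1.continuousAt
    have h2 : (Subtype.val ∘ f) = fun u : unitary R => F (1, u) := by funext u; exact (hf u).symm
    rw [h2]
    exact ContinuousAt.comp (x := u) (g := F) (f := fun u : unitary R => ((1 : ℂ), (u : R))) h1
      (by fun_prop)
  have hdc : Continuous fun u : unitary R => (aM bas F (1, u)).det := by
    rw [continuous_iff_continuousAt]
    intro u
    have hz := hF (1, u) hS1 (isUnit_unitary u)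
    have h1 : ContinuousAt (fun z => (aM bas F z).det) (1, (u : R)) :=
      (det_contDiffAt (aM_contDiffAt bas hz.1 hz.2)).continuousAt
    exact ContinuousAt.comp (x := u) (g := fun z => (aM bas F z).det)
      (f := fun u : unitary R => ((1 : ℂ), (u : R))) h1 (by fun_prop)
  obtain ⟨u0, -, hu0⟩ := (isCompact_univ (X := unitary R)).exists_isMaxOn ⟨1, trivial⟩
    (hrc.comp hfc).continuousOn
  obtain ⟨C, hC⟩ := (isCompact_univ (X := unitary R)).exists_bound_of_continuousOn hdc.continuousOn
  set c := r (f u0) with hcdef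
  have hc1 : c < 1 := lt_of_le_of_ne (hr1 _) fun h => hne u0 (hre _ h)
  have hcle : ∀ u, r (f u) ≤ c := fun u => hu0 (Set.mem_univ u)
  have hc0 : 0 ≤ c := hr0 _
  obtain ⟨b, hcb, hb1⟩ := exists_between hc1
  have hb0 : 0 < b := hc0.trans_lt hcb
  have hone : r 1 = 1 := by
    have := hr 1
    rw [show ((1 : unitary R) : R) = 1 from rfl, hφ1] at this
    exact_mod_cast this.symm
  set U : Set (unitary R) := {u | b < r u} with hU
  have hUo : IsOpen U := isOpen_lt continuous_const hrc
  have hUpos : 0 < μ.real U := by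
    refine ENNReal.toReal_pos ?_ (measure_ne_top μ U)
    exact hUo.measure_ne_zero μ ⟨1, by rw [hU, Set.mem_ofPred_eq, hone]; exact hb1⟩
  have hC0 : 0 ≤ C := (norm_nonneg _).trans (hC 1 trivial)
  have hup : ∀ N : ℕ, ‖∫ u : unitary R, (φ u) ^ N ∂μ‖ ≤ (c ^ N * C) * μ.real Set.univ := by
    intro N
    rw [← hc N]
    refine norm_integral_le_of_norm_le_const (ae_of_all _ fun u => ?_)
    rw [norm_mul, norm_pow, hf, hr, Complex.norm_real, Real.norm_of_nonneg (hr0 _)]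
    exact mul_le_mul (pow_le_pow_left₀ (hr0 _) (hcle u) N) (hC u trivial) (norm_nonneg _)
      (pow_nonneg hc0 N)
  have hlow : ∀ N : ℕ, b ^ N * μ.real U ≤ ‖∫ u : unitary R, (φ u) ^ N ∂μ‖ := by
    intro N
    have h1 : ∫ u : unitary R, (φ u) ^ N ∂μ = ((∫ u, r u ^ N ∂μ : ℝ) : ℂ) := by
      rw [← integral_complex_ofReal]
      refine integral_congr_ae (ae_of_all _ fun u => ?_)
      simp only [hr]
      norm_cast
    rw [h1, Complex.norm_real]
    refine le_trans ?_ (le_abs_self _)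
    have h2 := mul_meas_ge_le_integral_of_nonneg (μ := μ) (f := fun u => r u ^ N)
      (ae_of_all _ fun u => pow_nonneg (hr0 u) N)
      ((hrc.pow N).integrable_of_hasCompactSupport (HasCompactSupport.of_compactSpace _)) (b ^ N)
    refine le_trans ?_ h2
    refine mul_le_mul_of_nonneg_left ?_ (pow_nonneg hb0.le N)
    refine measureReal_mono (fun u hu => ?_)
    exact pow_le_pow_left₀ hb0.le (le_of_lt hu) N
  have hM : 0 ≤ μ.real Set.univ := measureReal_nonneg
  obtain ⟨N, hN⟩ := exists_pow_lt_of_lt_one (y := c / b) (x := μ.real U / (C * μ.real Set.univ + 1))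
    (by positivity) ((div_lt_one hb0).mpr hcb)
  have h3 := (hlow N).trans (hup N)
  rw [div_pow, div_lt_div_iff₀ (by positivity) (by positivity)] at hN
  have : 0 ≤ c ^ N := pow_nonneg hc0 N
  nlinarith
end degree

set_option linter.unusedSectionVars false
section words
open MeasureTheory Filter Topology
variable {R : Type*} [NormedRing R] [NormedAlgebra ℂ R] [CompleteSpace R] [StarRing R] [CStarRing R]
  [StarModule ℂ R] {H : Type*} [Group H]

/-- the good parameter set -/
def Sset (ρ : H →* unitary R) : Set ℂ := {s | ∀ g, IsUnit (1 + s • ((ρ g : R) - 1))}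

/-- The word map deformation exists. -/
def HasDef (ρ : H →* unitary R) (w : GZ H) : Prop :=
  ∃ F : ℂ × R → R, (∀ z : ℂ × R, z.1 ∈ Sset ρ → IsUnit z.2 → ContDiffAt ℂ ∞ F z ∧ IsUnit (F z)) ∧
    (∀ x : Rˣ, F (0, x) = ((Coprod.lift 1 (FreeGroup.lift fun _ => x) : GZ H →* Rˣ) w : Rˣ)) ∧
    (∀ u : unitary R, F (1, u) =
      ((Coprod.lift ρ (FreeGroup.lift fun _ => u) : GZ H →* unitary R) w : unitary R))

theorem HasDef.mul {ρ : H →* unitary R} {v w : GZ H} (hv : HasDef ρ v) (hw : HasDef ρ w) :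
    HasDef ρ (v * w) := by
  obtain ⟨F, h1, h2, h3⟩ := hv
  obtain ⟨F', h1', h2', h3'⟩ := hw
  refine ⟨fun z => F z * F' z, fun z hz hu => ⟨(h1 z hz hu).1.mul (h1' z hz hu).1,
    (h1 z hz hu).2.mul (h1' z hz hu).2⟩, fun x => ?_, fun u => ?_⟩
  · beta_reduce; rw [h2, h2', map_mul]; rfl
  · beta_reduce; rw [h3, h3', map_mul]; rfl

theorem HasDef.inv {ρ : H →* unitary R} {v : GZ H} (hv : HasDef ρ v) : HasDef ρ v⁻¹ := by
  obtain ⟨F, h1, h2, h3⟩ := hv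
  refine ⟨fun z => Ring.inverse (F z), fun z hz hu => ⟨?_, ?_⟩, fun x => ?_, fun u => ?_⟩
  · obtain ⟨y, hy⟩ := (h1 z hz hu).2
    have := contDiffAt_ringInverse (n := ∞) ℂ y
    rw [hy] at this
    exact this.comp z (h1 z hz hu).1
  · exact (h1 z hz hu).2.ringInverse
  · beta_reduce; rw [h2, map_inv, Ring.inverse_unit]
  · beta_reduce; rw [h3, map_inv]
    exact Ring.inverse_unit (Unitary.toUnits _)

theorem HasDef.one {ρ : H →* unitary R} : HasDef ρ (1 : GZ H) := by
  refine ⟨fun z => 1, fun z hz hu => ⟨contDiffAt_const, isUnit_one⟩, fun x => ?_, fun u => ?_⟩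
  · rw [map_one]; rfl
  · rw [map_one]; rfl

theorem hasDef (ρ : H →* unitary R) (w : GZ H) : HasDef ρ w := by
  induction w using Coprod.induction_on with
  | inl g =>
    refine ⟨fun z => 1 + z.1 • ((ρ g : R) - 1), fun z hz hu => ⟨?_, hz g⟩, fun x => ?_, fun u => ?_⟩
    · exact contDiffAt_const.add (contDiffAt_fst.smul contDiffAt_const)
    · simp
    · simp
  | inr m =>
    induction m using FreeGroup.induction_on with
    | C1 => rw [map_one]; exact HasDef.one
    | of x =>
      refine ⟨fun z => z.2, fun z hz hu => ⟨contDiffAt_snd, hu⟩, fun x => ?_, fun u => ?_⟩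
      · simp
      · simp
    | inv_of x hx => rw [map_inv]; exact hx.inv
    | mul x y hx hy => rw [map_mul]; exact hx.mul hy
  | mul x y hx hy => exact hx.mul hy

theorem Sset_open [Finite H] (ρ : H →* unitary R) : IsOpen (Sset ρ) := by
  have : Sset ρ = ⋂ g, {s : ℂ | IsUnit (1 + s • ((ρ g : R) - 1))} := by
    ext s; simp [Sset]
  rw [this]
  refine isOpen_iInter_of_finite fun g => ?_
  exact Units.isOpen.preimage (f := fun s : ℂ => 1 + s • ((ρ g : R) - 1)) (by fun_prop)

theorem Sset_conn [Finite H] (ρ : H →* unitary R) (hs : ∀ g, (spectrum ℂ (ρ g : R)).Finite) :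
    IsPreconnected (Sset ρ) := by
  have hfin : (⋃ g, (fun y : ℂ => (1 - y)⁻¹) '' spectrum ℂ (ρ g : R)).Finite :=
    Set.finite_iUnion fun g => (hs g).image _
  have hcs : (Sset ρ)ᶜ.Countable := by
    refine (hfin.subset fun s hs => ?_).countable
    simp only [Sset, Set.mem_compl_iff, Set.mem_ofPred_eq, not_forall] at hs
    obtain ⟨g, hg⟩ := hs
    have hs0 : s ≠ 0 := by
      rintro rfl
      exact hg (by simp)
    refine Set.mem_iUnion.mpr ⟨g, 1 - s⁻¹, ?_, by simp⟩
    rw [spectrum.mem_iff]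
    intro hu
    apply hg
    have hu2 := (hu.neg).smul (Units.mk0 s hs0)
    have e : Units.mk0 s hs0 • (-(algebraMap ℂ R (1 - s⁻¹) - (ρ g : R))) =
        1 + s • ((ρ g : R) - 1) := by
      rw [Units.smul_def, Units.val_mk0, Algebra.algebraMap_eq_smul_one, neg_sub, smul_sub, smul_smul,
        mul_sub, mul_inv_cancel₀ hs0, mul_one, sub_smul, one_smul, smul_sub]
      abel
    rwa [e] at hu2
  have := hcs.isPathConnected_compl_of_one_lt_rank (by rw [Complex.rank_real_complex]; norm_num)
  rw [compl_compl] at this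
  exact this.isConnected.isPreconnected

theorem GRabs [FiniteDimensional ℂ R] [Finite H] {ι : Type*} [Fintype ι] [DecidableEq ι]
    (bas : Module.Basis ι ℂ R)
    (hun : ∀ v : R, ∑ p, bas.repr (v * bas p - bas p * v) p = 0)
    (φ : R → ℂ) (hφ : ∀ x, IsUnit x → ContDiffAt ℂ ∞ φ x) (hφ1 : φ 1 = 1)
    (r : unitary R → ℝ) (hr : ∀ u : unitary R, φ u = r u) (hr0 : ∀ u, 0 ≤ r u)
    (hr1 : ∀ u, r u ≤ 1) (hre : ∀ u, r u = 1 → u = 1)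
    (hs : ∀ x : R, (spectrum ℂ x).Finite)
    (ρ : H →* unitary R) (w : GZ H) (hw : expSum H w = Multiplicative.ofAdd 1) :
    ∃ u : unitary R, (Coprod.lift ρ (FreeGroup.lift fun _ => u) : GZ H →* unitary R) w = 1 := by
  obtain ⟨F, h1, h2, h3⟩ := hasDef ρ w
  refine degree bas hun φ hφ hφ1 r hr hr0 hr1 hre (Sset_open ρ) (Sset_conn ρ fun g => hs _)
    ?_ ?_ h1 ?_ _ h3
  · intro g; simp
  · intro g
    have := isUnit_unitary (ρ g)
    simpa using this
  · rintro _ ⟨x, rfl⟩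
    rw [h2]
    have : (Coprod.lift 1 (FreeGroup.lift fun _ => x) : GZ H →* Rˣ) =
        (zpowersHom Rˣ x).comp (expSum H) := by
      refine Coprod.hom_ext ?_ ?_
      · ext g; simp [expSum]
      · refine FreeGroup.ext_hom _ _ fun i => ?_
        simp [expSum, zpowersHom_apply]
    rw [this, MonoidHom.comp_apply, hw]
    simp [zpowersHom_apply]
end words

universe u
set_option linter.unusedSectionVars false
section matsp
open scoped Matrix.Norms.L2Operator ComplexOrder
variable {n : Type*} [Fintype n] [DecidableEq n] [Nonempty n] {H : Type*} [Group H]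

theorem re_tr_le (u : unitary (Matrix n n ℂ)) (i : n) : |((u : Matrix n n ℂ) i i).re| ≤ 1 :=
  (Complex.abs_re_le_norm _).trans (entry_norm_bound_of_unitary u.2 i i)

theorem re_tr_abs (u : unitary (Matrix n n ℂ)) :
    |((u : Matrix n n ℂ).trace).re| ≤ Fintype.card n := by
  rw [Matrix.trace, Complex.re_sum]
  refine (Finset.abs_sum_le_sum_abs _ _).trans ?_
  refine (Finset.sum_le_sum fun i _ => re_tr_le u i).trans ?_
  simp

theorem tr_eq_one (u : unitary (Matrix n n ℂ)) (h : ((u : Matrix n n ℂ).trace).re = Fintype.card n) :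
    u = 1 := by
  have hu : (u : Matrix n n ℂ) * (u : Matrix n n ℂ)ᴴ = 1 := Unitary.mul_star_self_of_mem u.2
  have h1 : ((1 - (u : Matrix n n ℂ)) * (1 - (u : Matrix n n ℂ))ᴴ).trace = 0 := by
    have e : (1 - (u : Matrix n n ℂ)) * (1 - (u : Matrix n n ℂ))ᴴ =
        1 - (u : Matrix n n ℂ) - (u : Matrix n n ℂ)ᴴ + 1 := by
      rw [Matrix.conjTranspose_sub, Matrix.conjTranspose_one, sub_mul, mul_sub, mul_sub, hu]
      simp; abel
    rw [e, Matrix.trace_add, Matrix.trace_sub, Matrix.trace_sub, Matrix.trace_one,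
      Matrix.trace_conjTranspose]
    apply Complex.ext
    · simp [h]
    · simp
  rw [Matrix.trace_mul_conjTranspose_self_eq_zero_iff, sub_eq_zero] at h1
  exact Subtype.ext h1.symm

theorem GRmat [Finite H] (ρ : H →* unitary (Matrix n n ℂ)) (w : GZ H)
    (hw : expSum H w = Multiplicative.ofAdd 1) :
    ∃ u : unitary (Matrix n n ℂ),
      (Coprod.lift ρ (FreeGroup.lift fun _ => u) : GZ H →* unitary (Matrix n n ℂ)) w = 1 := by
  have hn : (0 : ℝ) < Fintype.card n := by exact_mod_cast Fintype.card_pos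
  have hn' : (Fintype.card n : ℂ) ≠ 0 := by exact_mod_cast hn.ne'
  have htr : ContDiff ℂ ∞ (fun y : Matrix n n ℂ => y.trace) :=
    (LinearMap.toContinuousLinearMap (Matrix.traceLinearMap n ℂ ℂ)).contDiff
  refine GRabs (Matrix.stdBasis ℂ n n) ?_
    (fun y => (2 * (Fintype.card n : ℂ) + y.trace + (Ring.inverse y).trace) / (4 * Fintype.card n))
    ?_ ?_ (fun u => (Fintype.card n + ((u : Matrix n n ℂ).trace).re) / (2 * Fintype.card n))
    ?_ ?_ ?_ ?_ (fun x => Matrix.finite_spectrum x) ρ w hw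
  · intro v
    have hrep : ∀ (x : Matrix n n ℂ) (p : n × n), (Matrix.stdBasis ℂ n n).repr x p = x p.1 p.2 := by
      intro x p; simp [Matrix.stdBasis]
    simp_rw [hrep, Fintype.sum_prod_type, Matrix.stdBasis_eq_single]
    simp [Matrix.mul_single_apply_same, Matrix.single_mul_apply_same]
    rw [Finset.mul_sum, sub_self]
  · rintro _ ⟨x, rfl⟩
    have h2 := contDiffAt_ringInverse (n := ∞) ℂ x
    have h3 : ContDiffAt ℂ ∞ (fun y : Matrix n n ℂ => (Ring.inverse y).trace) x :=
      htr.contDiffAt.comp (x : Matrix n n ℂ) h2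
    exact ((contDiffAt_const.add htr.contDiffAt).add h3).div_const _
  · simp only [Matrix.trace_one, Ring.inverse_one]
    field_simp; norm_num
  · intro u
    have e : Ring.inverse (u : Matrix n n ℂ) = (u : Matrix n n ℂ)ᴴ :=
      Ring.inverse_unit (Unitary.toUnits u)
    beta_reduce
    rw [e, Matrix.trace_conjTranspose, add_assoc, Complex.star_def, Complex.add_conj]
    push_cast
    field_simp
    ring
  · intro u
    have := abs_le.mp (re_tr_abs u)
    apply div_nonneg <;> linarith
  · intro u
    have := abs_le.mp (re_tr_abs u)
    rw [div_le_one (by positivity)]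
    linarith
  · intro u h
    rw [div_eq_one_iff_eq (by positivity)] at h
    exact tr_eq_one u (by linarith)

/-- The regular representation. -/
def regMat (H : Type*) [Group H] [DecidableEq H] (h : H) : Matrix H H ℂ :=
  Matrix.of fun a b => if a = h * b then 1 else 0

theorem regMat_mul (H : Type*) [Group H] [DecidableEq H] [Fintype H] (g h : H) :
    regMat H (g * h) = regMat H g * regMat H h := by
  ext a b
  simp [regMat, Matrix.mul_apply, mul_assoc]

theorem regMat_one (H : Type*) [Group H] [DecidableEq H] : regMat H 1 = 1 := by
  ext a b
  simp [regMat, Matrix.one_apply]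

theorem regMat_star (H : Type*) [Group H] [DecidableEq H] (h : H) :
    star (regMat H h) = regMat H h⁻¹ := by
  ext a b
  have : b = h * a ↔ a = h⁻¹ * b := by rw [eq_inv_mul_iff_mul_eq, eq_comm]
  simp [regMat, Matrix.star_apply, this, apply_ite]

theorem GRreg (H : Type u) [Group H] [Finite H] : ∃ (U : Type u) (_ : Group U) (ρ : H →* U),
    Function.Injective ρ ∧ ∀ w : GZ H, expSum H w = Multiplicative.ofAdd 1 →
      ∃ u : U, (Coprod.lift ρ (FreeGroup.lift fun _ => u) : GZ H →* U) w = 1 := by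
  classical
  have := Fintype.ofFinite H
  let ρ : H →* unitary (Matrix H H ℂ) :=
    { toFun := fun h => ⟨regMat H h, by
        rw [Unitary.mem_iff, regMat_star, ← regMat_mul, ← regMat_mul, inv_mul_cancel,
          mul_inv_cancel, regMat_one]
        exact ⟨rfl, rfl⟩⟩
      map_one' := Subtype.ext (regMat_one H)
      map_mul' := fun g h => Subtype.ext (regMat_mul H g h) }
  refine ⟨unitary (Matrix H H ℂ), inferInstance, ρ, ?_, fun w hw => GRmat ρ w hw⟩
  intro g h e
  have e1 : regMat H g = regMat H h := congrArg Subtype.val e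
  have e2 := congrFun (congrFun e1 g) 1
  simp only [regMat, Matrix.of_apply, mul_one, if_true] at e2
  by_contra hne
  simp [hne] at e2
end matsp

section gp
variable {G : Type u} [Group G]

theorem dich {w : GZ G} (hS : IsSimpleGroup (Gtilde G w)) {U : Type*} [Group U] (ψ : GZ G →* U)
    (h : ψ w = 1) : (∀ x, ψ x = 1) ∨ ∀ x, ψ x = 1 → (x : Gtilde G w) = 1 := by
  have hN : Subgroup.normalClosure {w} ≤ ψ.ker :=
    Subgroup.normalClosure_le_normal (by simpa using h)
  let Ψ : Gtilde G w →* U := QuotientGroup.lift _ ψ hN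
  rcases hS.eq_bot_or_eq_top_of_normal Ψ.ker inferInstance with hk | hk
  · right
    intro x hx
    have : (x : Gtilde G w) ∈ Ψ.ker := hx
    rw [hk] at this
    exact this
  · left
    intro x
    have : (x : Gtilde G w) ∈ Ψ.ker := by rw [hk]; trivial
    exact this

theorem dich_comm {w : GZ G} (hS : IsSimpleGroup (Gtilde G w))
    (hc : ¬ ∀ a b : Gtilde G w, a * b = b * a) {U : Type*} [CommGroup U] (ψ : GZ G →* U)
    (h : ψ w = 1) (x : GZ G) : ψ x = 1 := by
  rcases dich hS ψ h with h1 | h1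
  · exact h1 x
  · exfalso
    apply hc
    intro a b
    induction a using QuotientGroup.induction_on with | H a => ?_
    induction b using QuotientGroup.induction_on with | H b => ?_
    have := h1 (a * b * (b * a)⁻¹) (by simp [mul_comm (ψ a)])
    rw [QuotientGroup.mk_mul, QuotientGroup.mk_inv, mul_inv_eq_one] at this
    exact this

theorem expSum_cases {w : GZ G} (hS : IsSimpleGroup (Gtilde G w))
    (hc : ¬ ∀ a b : Gtilde G w, a * b = b * a) : ∃ w' : GZ G,
      expSum G w' = Multiplicative.ofAdd 1 ∧ (w' = w ∨ w' = w⁻¹) := by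
  set k : ℤ := Multiplicative.toAdd (expSum G w) with hk
  have hk' : expSum G w = Multiplicative.ofAdd k := rfl
  let q : Multiplicative ℤ →* Multiplicative (ZMod k.natAbs) :=
    AddMonoidHom.toMultiplicative (Int.castAddHom (ZMod k.natAbs))
  have h1 := dich_comm hS hc (q.comp (expSum G)) (by
    rw [MonoidHom.comp_apply, hk']
    change Multiplicative.ofAdd ((k : ℤ) : ZMod k.natAbs) = 1
    rw [ofAdd_eq_one, ZMod.intCast_zmod_eq_zero_iff_dvd]
    simp) (tGen G)
  have h2 : ((1 : ℤ) : ZMod k.natAbs) = 0 := by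
    have : expSum G (tGen G) = Multiplicative.ofAdd 1 := by simp [expSum, tGen]
    rw [MonoidHom.comp_apply, this] at h1
    exact h1
  rw [ZMod.intCast_zmod_eq_zero_iff_dvd, Int.natAbs_dvd] at h2
  rcases Int.isUnit_iff.mp (isUnit_of_dvd_one h2) with h3 | h3
  · exact ⟨w, by rw [hk', h3], Or.inl rfl⟩
  · exact ⟨w⁻¹, by rw [map_inv, hk', h3]; rfl, Or.inr rfl⟩

theorem triv_comm [Subsingleton G] (x y : GZ G) : x * y = y * x := by
  have e : MonoidHom.id (GZ G) = (zpowersHom (GZ G) (tGen G)).comp (expSum G) := by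
    refine Coprod.hom_ext ?_ ?_
    · ext g
      rw [Subsingleton.elim g 1]; simp
    · refine FreeGroup.ext_hom _ _ fun i => ?_
      simp [expSum, tGen, zpowersHom_apply]
  have ex : ∀ x, x = zpowersHom (GZ G) (tGen G) (expSum G x) := fun x => DFunLike.congr_fun e x
  rw [ex (x * y), map_mul (expSum G), mul_comm (expSum G x), ← map_mul (expSum G), ← ex]

theorem ab_hom {A : Type*} [CommGroup A] (w : GZ A) (hw : expSum A w = Multiplicative.ofAdd 1) :
    ∃ ψ : GZ A →* A, ψ w = 1 ∧ ∀ g, ψ (Coprod.inl g) = g := by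
  let ψ0 : GZ A →* A := Coprod.lift (MonoidHom.id A) 1
  refine ⟨ψ0 * (zpowersHom A (ψ0 w)⁻¹).comp (expSum A), ?_, fun g => ?_⟩
  · rw [MonoidHom.mul_apply, MonoidHom.comp_apply, hw, zpowersHom_apply]
    simp
  · rw [MonoidHom.mul_apply, MonoidHom.comp_apply]
    simp [ψ0, expSum]

end gp

/-- **Theorem 1**: if `G` is finite and not nonabelian simple, then `G̃` is not
nonabelian simple. -/
theorem theorem1 (G : Type*) [Group G] [Finite G]
    (hG : ¬ (IsSimpleGroup G ∧ ¬ ∀ a b : G, a * b = b * a)) (w : GZ G) :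
    ¬ (IsSimpleGroup (Gtilde G w) ∧ ¬ ∀ a b : Gtilde G w, a * b = b * a) := by
  rintro ⟨hS, hc⟩
  obtain ⟨w', hw', hww⟩ := expSum_cases hS hc
  have hk : ∀ {U : Type _} [Group U] (ψ : GZ G →* U), ψ w' = 1 → ψ w = 1 := by
    intro U _ ψ h
    rcases hww with rfl | rfl
    · exact h
    · simpa using h
  have hnt : Nontrivial G := by
    by_contra hn
    rw [not_nontrivial_iff_subsingleton] at hn
    apply hc
    intro a b
    induction a using QuotientGroup.induction_on with | H a => ?_
    induction b using QuotientGroup.induction_on with | H b => ?_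
    rw [← QuotientGroup.mk_mul, triv_comm, QuotientGroup.mk_mul]
  by_cases hab : ∀ a b : G, a * b = b * a
  · let _ : CommGroup G := { ‹Group G› with mul_comm := hab }
    obtain ⟨ψ, h1, h2⟩ := ab_hom w' hw'
    obtain ⟨g, hg⟩ := exists_ne (1 : G)
    exact hg (by rw [← h2 g]; exact dich_comm hS hc ψ (hk ψ h1) _)
  · have hns : ¬ IsSimpleGroup G := fun h => hG ⟨h, hab⟩
    have hN : ∃ N : Subgroup G, N.Normal ∧ N ≠ ⊥ ∧ N ≠ ⊤ := by
      by_contra! hcon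
      refine hns ⟨fun N hN => ?_⟩
      by_cases hb : N = ⊥
      · exact Or.inl hb
      · exact Or.inr (hcon N hN hb)
    obtain ⟨N, hNn, hb, ht⟩ := hN
    -- injectivity of the natural map
    have hinj : ∀ g : G, ((Coprod.inl g : GZ G) : Gtilde G w) = 1 → g = 1 := by
      obtain ⟨U, _, ρ, hρ, hGR⟩ := GRreg G
      obtain ⟨u, hu⟩ := hGR w' hw'
      intro g hg
      have hle : Subgroup.normalClosure {w} ≤
          (Coprod.lift ρ (FreeGroup.lift fun _ => u) : GZ G →* U).ker :=
        Subgroup.normalClosure_le_normal (by simpa using hk _ hu)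
      have := hle ((QuotientGroup.eq_one_iff _).mp hg)
      rw [MonoidHom.mem_ker, Coprod.lift_apply_inl] at this
      exact hρ (this.trans (map_one ρ).symm)
    obtain ⟨U, _, ρ, hρ, hGR⟩ := GRreg (G ⧸ N)
    let m : GZ G →* GZ (G ⧸ N) := Coprod.map (QuotientGroup.mk' N) (MonoidHom.id _)
    have hm : expSum (G ⧸ N) (m w') = Multiplicative.ofAdd 1 := by
      rw [← hw', ← MonoidHom.comp_apply]
      congr 1
      refine Coprod.hom_ext ?_ ?_
      · ext g
        simp [expSum, m]
      · refine FreeGroup.ext_hom _ _ fun i => ?_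
        simp [expSum, m]
    obtain ⟨u, hu⟩ := hGR (m w') hm
    let ψ : GZ G →* U := (Coprod.lift ρ (FreeGroup.lift fun _ => u)).comp m
    have hψ : ∀ g : G, ψ (Coprod.inl g) = ρ (g : G ⧸ N) := by
      intro g; simp [ψ, m]
    rcases dich hS ψ (hk ψ hu) with h | h
    · apply ht
      rw [eq_top_iff]
      intro g _
      have h1 := h (Coprod.inl g)
      rw [hψ] at h1
      exact (QuotientGroup.eq_one_iff g).mp (hρ (h1.trans (map_one ρ).symm))
    · apply hb
      rw [eq_bot_iff]
      intro g hg
      refine hinj g (h _ ?_)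
      rw [hψ, (QuotientGroup.eq_one_iff g).mpr hg, map_one]
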